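/- Let j be an integer with (m+1)/2 < j ≤ m. Then for every u ∈ V_Spin: A_{(j)} · u = Σ_{I ⊆ {1,…,m+1−j}} (−1)^(s(I)) (1/2) [ δ(w_{ρ_{m+1−j}^I})(u) · w_{μ_{m+1−j}^I} + δ(w_{μ_{m+1−j}^I})(u) · w_{ρ_{m+1−j}^I} ]. That is, the Clifford action of A_{(j)} on V_Spin equals the image in End(V_Spin), under the map w w′ ↦ (1/2)(δ(w) ⊗ w′ + δ(w′) ⊗ w), of the element D_{(j)} := Σ_{I ⊆ {1,…,m+1−j}} (−1)^(s(I)) w_{ρ_{m+1−j}^I} w_{μ_{m+1−j}^I} of Sym²(V_Spin). -/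

import Mathlib

/-!
Formalization of a statement from "A Landau-Ginzburg model for Lagrangian
Grassmannians, Langlands duality, and relations in quantum cohomology"
(arXiv:1304.4958).

Conventions: `V = ℂ^(2m+1)` with 0-based coordinates (`a : Fin (2m+1)`
corresponds to the paper's 1-based basis index `i = a+1`);
`ε(i) = (−1)^(m+1−i)`, written as `(−1)^(m+1+i)` which has the same parity.
-/

noncomputable section
open scoped BigOperators

def eps (m i : ℕ) : ℂ := (-1 : ℂ) ^ (m + 1 + i)

/-- The spin representation `V_Spin = ⋀•W`, modelled by coordinates with respect to its
basis `{w_I}` indexed by the subsets `I ⊆ {1,…,m}` (encoded as `Finset (Fin m)`: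
the element `a : Fin m` stands for the paper index `a+1`, i.e. the basis vector
`v_{a+1}` of `W`). -/
abbrev VS (m : ℕ) := Finset (Fin m) → ℂ

/-- The basis vector `w_I` of `V_Spin`. -/
def wB {m : ℕ} (I : Finset (Fin m)) : VS m := fun L => if L = I then 1 else 0

/-- The action of `v_{a+1}` (for `a : Fin m`) on `V_Spin`, i.e. wedging with `v_{a+1}`:
`v_{a+1} ⋅ w_L = (−1)^{#{l ∈ L : l < a}} w_{L ∪ {a}}` if `a ∉ L`, and `0` otherwise. -/
def crtF (m : ℕ) (a : Fin m) : Module.End ℂ (VS m) :=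
  Matrix.mulVecLin (Matrix.of fun L' L : Finset (Fin m) =>
    if a ∈ L' ∧ L = L'.erase a then (-1 : ℂ) ^ ((L'.filter (· < a)).card) else 0)

/-- The action of `v̄_{a+1}` (for `a : Fin m`) on `V_Spin`: the interior product
(insertion operator) contracting with the linear form `2Φ(v̄_{a+1}, −)` on `W`. -/
def annF (m : ℕ) (a : Fin m) : Module.End ℂ (VS m) :=
  Matrix.mulVecLin (Matrix.of fun L' L : Finset (Fin m) =>
    if a ∈ L ∧ L' = L.erase a then
      (-1 : ℂ) ^ ((L.filter (· < a)).card) * eps m ((a : ℕ) + 1) else 0)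

/-- The action of `v_{m+1}` on `V_Spin`: multiplication by `(−1)^k/√2` on `⋀^k W`. -/
def midF (m : ℕ) : Module.End ℂ (VS m) :=
  Matrix.mulVecLin (Matrix.of fun L' L : Finset (Fin m) =>
    if L' = L then (-1 : ℂ) ^ (L.card) * (((Real.sqrt 2 : ℝ) : ℂ))⁻¹ else 0)

/-- The action on `V_Spin` of the Clifford generator `v_i`, for a paper index
`i ∈ {1,…,2m+1}`: wedging for `i ≤ m`, the scalar `(−1)^k/√2` for `i = m+1`, and
the insertion operator for `v̄_{2m+2−i}` when `i ≥ m+2`. -/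
def genOpF (m : ℕ) (i : ℕ) : Module.End ℂ (VS m) :=
  if h : 1 ≤ i ∧ i ≤ m then crtF m ⟨i - 1, by omega⟩
  else if i = m + 1 then midF m
  else if h2 : m + 2 ≤ i ∧ i ≤ 2 * m + 1 then annF m ⟨2 * m + 1 - i, by omega⟩
  else 0

/-- The action on `V_Spin` of the ordered product `v_K = v_{k_1} v_{k_2} ⋯ v_{k_r}` of
Clifford generators, for a set of paper indices `K = {k_1 < ⋯ < k_r} ⊆ {1,…,2m+1}`. -/
def prodOpF (m : ℕ) (K : Finset ℕ) : Module.End ℂ (VS m) :=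
  ((K.sort (· ≤ ·)).map (genOpF m)).prod

/-- `|λ(I)| = Σ_{a ∈ I} (m − a)`: the weight of the strict partition whose index set is
`I` (the element `a : Fin m`, i.e. paper index `a+1 = m+1−p`, corresponds to the part
`p = m−a`). -/
def psum (m : ℕ) (I : Finset (Fin m)) : ℕ := ∑ a ∈ I, (m - (a : ℕ))

/-- The dual basis vector `w*_K ∈ V_Spin^*`, the coordinate functional at `K`. -/
def wStar {m : ℕ} (K : Finset (Fin m)) : Module.Dual ℂ (VS m) := LinearMap.proj K

/-- The linear map `δ : V_Spin → V_Spin^*` determined by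
`δ(w_λ) = (−1)^{|λ|} w*_{PD(λ)}`; Poincaré duality `PD` corresponds to complementation
of index subsets of `{1,…,m}`. -/
def deltaF (m : ℕ) : VS m →ₗ[ℂ] Module.Dual ℂ (VS m) where
  toFun f := ∑ I : Finset (Fin m), ((-1 : ℂ) ^ (psum m I) * f I) • wStar Iᶜ
  map_add' f g := by simp [mul_add, add_smul, Finset.sum_add_distrib]
  map_smul' c f := by simp [Finset.smul_sum, smul_smul, mul_left_comm]

/-- The index set `I(λ) ⊆ {1,…,m}` (as a `Finset (Fin m)`) of the strict partition with
set of parts `P`: the part `p ∈ P` corresponds to the paper index `m+1−p`, i.e. to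
`a : Fin m` with `a = m−p`. -/
def IofP (m : ℕ) (P : Finset ℕ) : Finset (Fin m) :=
  Finset.univ.filter (fun a => m - (a : ℕ) ∈ P)

/-- The basis vector `w_λ` of `V_Spin`, for the strict partition `λ` whose set of parts is
`P ⊆ {1,…,m}`. -/
def wP (m : ℕ) (P : Finset ℕ) : VS m := wB (IofP m P)

/-- `s(J) = Σ_{j ∈ J} j`. -/
def sJ (J : Finset ℕ) : ℕ := ∑ j ∈ J, j

/-- `w_{μ_l^J}`: `μ_l = (m, m−1, …, m+1−l)` has set of parts `Icc (m+1−l) m`; `μ_l^J` adds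
to it a row of length `j` for each `j ∈ J`, and `w_{μ_l^J} = 0` if the result is not a
strict partition. -/
def wMu (m l : ℕ) (J : Finset ℕ) : VS m :=
  if Disjoint (Finset.Icc (m + 1 - l) m) J then wP m (Finset.Icc (m + 1 - l) m ∪ J) else 0

/-- The action on `V_Spin` of the element `A_{(j)} ∈ Cl(V)`:
`A_{(j)} = ((−1)^(m(m+1)/2)/2) [ 2 v_{{1,…,m+1−j} ∪ {2m+3−j,…,2m+1}}
  + Σ_{I ⊊ {1,…,m+1−j}} ( Π_{l ∈ {1,…,m+1−j}∖I} (−1)^l ) v_{I ∪ {2m+3−j,…,m+j} ∪ Ī} ]`. -/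
def AOpF (m j : ℕ) : Module.End ℂ (VS m) :=
  ((-1 : ℂ) ^ (m * (m + 1) / 2) / 2) •
    ((2 : ℂ) • prodOpF m (Finset.Icc 1 (m + 1 - j) ∪ Finset.Icc (2 * m + 3 - j) (2 * m + 1))
      + ∑ I ∈ (Finset.Icc 1 (m + 1 - j)).powerset.filter (· ≠ Finset.Icc 1 (m + 1 - j)),
          (∏ l ∈ Finset.Icc 1 (m + 1 - j) \ I, (-1 : ℂ) ^ l) •
            prodOpF m (I ∪ Finset.Icc (2 * m + 3 - j) (m + j) ∪
              I.image (fun i => 2 * m + 2 - i)))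


section CliffordAction

variable {m : ℕ}

/-- The sign picked up when moving a generator of index `a` into its place in `w_L`. -/
def transSign (L : Finset (Fin m)) (a : Fin m) : ℂ := (-1 : ℂ) ^ (L.filter (· < a)).card

/-- The product of the signs `ε(a + 1)` over `a ∈ S`. -/
def epsProd (S : Finset (Fin m)) : ℂ := ∏ a ∈ S, eps m ((a : ℕ) + 1)

lemma crtF_apply (a : Fin m) (u : VS m) (L : Finset (Fin m)) :
    crtF m a u L = if a ∈ L then transSign L a * u (L.erase a) else 0 := by
  simp only [crtF, Matrix.mulVecLin_apply, Matrix.mulVec, dotProduct, Matrix.of_apply, transSign]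
  by_cases h : a ∈ L <;> simp [h]

lemma annF_apply (a : Fin m) (u : VS m) (L : Finset (Fin m)) :
    annF m a u L
      = if a ∉ L then transSign L a * eps m ((a : ℕ) + 1) * u (insert a L) else 0 := by
  simp only [annF, Matrix.mulVecLin_apply, Matrix.mulVec, dotProduct, Matrix.of_apply, transSign]
  by_cases h : a ∈ L
  · rw [if_neg (not_not.mpr h)]
    refine Finset.sum_eq_zero fun K _ => ?_
    rw [if_neg, zero_mul]
    rintro ⟨-, rfl⟩
    simp at h
  · rw [if_pos h, Finset.sum_eq_single (insert a L)]
    · rw [if_pos ⟨Finset.mem_insert_self _ _, (Finset.erase_insert h).symm⟩,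
        Finset.filter_insert, if_neg (lt_irrefl a)]
    · intro K _ hK
      rw [if_neg, zero_mul]
      rintro ⟨haK, rfl⟩
      exact hK (Finset.insert_erase haK).symm
    · simp

lemma genOpF_succ (a : Fin m) : genOpF m ((a : ℕ) + 1) = crtF m a := by
  have := a.isLt
  rw [genOpF, dif_pos ⟨by omega, by omega⟩]
  simp

lemma genOpF_bar (a : Fin m) : genOpF m (2 * m + 1 - (a : ℕ)) = annF m a := by
  have := a.isLt
  rw [genOpF, dif_neg (by omega), if_neg (by omega), dif_pos ⟨by omega, by omega⟩]
  congr 1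
  ext
  simp only
  omega

lemma prodOpF_insert {k : ℕ} {K : Finset ℕ} (h : ∀ b ∈ K, k < b) :
    prodOpF m (insert k K) = genOpF m k * prodOpF m K := by
  rw [prodOpF, Finset.sort_insert _ (fun b hb => (h b hb).le) fun hk => lt_irrefl _ (h k hk)]
  simp [prodOpF]

lemma prodOpF_bar_apply (S : Finset (Fin m)) (u : VS m) (L : Finset (Fin m)) :
    prodOpF m (S.image fun a : Fin m => 2 * m + 1 - (a : ℕ)) u L
      = if Disjoint S L then (∏ a ∈ S, transSign L a) * epsProd S * u (L ∪ S) else 0 := by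
  induction S using Finset.induction_on_max generalizing L with
  | empty => simp [prodOpF, epsProd]
  | insert a S hS ih =>
    have haS : a ∉ S := fun h => lt_irrefl _ (hS a h)
    rw [Finset.image_insert, prodOpF_insert, genOpF_bar, Module.End.mul_apply, annF_apply, ih]
    · by_cases ha : a ∈ L
      · simp [ha]
      · have hd : Disjoint S (insert a L) ↔ Disjoint S L := by
          simp [Finset.disjoint_insert_right, haS]
        have hsign : ∏ b ∈ S, transSign (insert a L) b = ∏ b ∈ S, transSign L b := by
          refine Finset.prod_congr rfl fun b hb => ?_
          rw [transSign, transSign, Finset.filter_insert, if_neg (hS b hb).not_gt]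
        rw [if_pos ha]
        simp only [hd, hsign, Finset.disjoint_insert_left, ha, not_false_eq_true, true_and,
          Finset.prod_insert haS, epsProd, Finset.insert_union, Finset.union_insert]
        split_ifs
        · ring
        · simp
    · intro b hb
      obtain ⟨c, hc, rfl⟩ := Finset.mem_image.mp hb
      have := hS c hc
      have := a.isLt
      omega

lemma prodOpF_apply (I S : Finset (Fin m)) (u : VS m) (L : Finset (Fin m)) :
    prodOpF m (I.image (fun a : Fin m => (a : ℕ) + 1) ∪ S.image fun a : Fin m => 2 * m + 1 - (a : ℕ)) u L
      = if I ⊆ L ∧ Disjoint S (L \ I) then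
          (∏ a ∈ I, transSign (L \ I) a) * (∏ a ∈ S, transSign (L \ I) a) * epsProd S
            * u (L \ I ∪ S)
        else 0 := by
  induction I using Finset.induction_on_min generalizing L with
  | empty => simp [prodOpF_bar_apply]
  | insert a I hI ih =>
    have haI : a ∉ I := fun h => lt_irrefl _ (hI a h)
    rw [Finset.image_insert, Finset.insert_union, prodOpF_insert, genOpF_succ,
      Module.End.mul_apply, crtF_apply, ih]
    · by_cases ha : a ∈ L
      · have hd : L.erase a \ I = L \ insert a I := by
          ext x; simp only [Finset.mem_sdiff, Finset.mem_erase, Finset.mem_insert]; tauto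
        have hs : I ⊆ L.erase a ↔ insert a I ⊆ L := by
          simp [Finset.subset_erase, Finset.insert_subset_iff, ha, haI]
        have hsign : transSign L a = transSign (L \ insert a I) a := by
          rw [transSign, transSign]
          congr 2
          ext x
          simp only [Finset.mem_filter, Finset.mem_sdiff, Finset.mem_insert, not_or]
          refine ⟨fun h => ⟨⟨h.1, h.2.ne, fun hx => (hI x hx).not_gt h.2⟩, h.2⟩,
            fun h => ⟨h.1.1, h.2⟩⟩
        rw [if_pos ha, hd, hsign, Finset.prod_insert haI]
        simp only [hs]
        split_ifs
        · ring
        · simp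
      · simp [ha, Finset.insert_subset_iff]
    · intro b hb
      rcases Finset.mem_union.mp hb with hb | hb
      · obtain ⟨c, hc, rfl⟩ := Finset.mem_image.mp hb
        have := hI c hc
        omega
      · obtain ⟨c, hc, rfl⟩ := Finset.mem_image.mp hb
        have := a.isLt
        have := c.isLt
        omega

lemma deltaF_wB (I : Finset (Fin m)) (u : VS m) :
    deltaF m (wB I) u = (-1 : ℂ) ^ psum m I * u Iᶜ := by
  simp [deltaF, wB, wStar]

lemma transSign_mul_self (L : Finset (Fin m)) (a : Fin m) :
    transSign L a * transSign L a = 1 := by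
  rw [transSign, ← mul_pow]; simp

lemma epsProd_eq (S : Finset (Fin m)) : epsProd S = (-1 : ℂ) ^ psum m S := by
  rw [epsProd, psum, ← Finset.prod_pow_eq_pow_sum]
  refine Finset.prod_congr rfl fun a _ => ?_
  have := a.isLt
  rw [eps, show m + 1 + ((a : ℕ) + 1) = (m - a) + 2 * (a + 1) by omega, pow_add, pow_mul]
  simp

lemma epsProd_mul_self (S : Finset (Fin m)) : epsProd S * epsProd S = 1 := by
  rw [epsProd_eq, ← mul_pow]; simp

lemma epsProd_univ : epsProd (Finset.univ : Finset (Fin m)) = (-1 : ℂ) ^ (m * (m + 1) / 2) := by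
  rw [epsProd_eq, psum, Fin.sum_univ_eq_sum_range (fun a => m - a) m]
  congr 1
  have h := Finset.sum_range_reflect (fun i => i + 1) m
  have h2 := Finset.sum_range_id_mul_two (m + 1)
  rw [Finset.sum_range_succ'] at h2
  have h3 : ∑ a ∈ Finset.range m, (m - a) = ∑ i ∈ Finset.range m, (i + 1) := by
    rw [← h]
    refine Finset.sum_congr rfl fun a ha => ?_
    have := Finset.mem_range.mp ha
    omega
  rw [h3]
  have h4 : (m + 1) * (m + 1 - 1) = m * (m + 1) := by
    rw [Nat.add_sub_cancel, mul_comm]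
  omega

end CliffordAction

section Blocks

/-- The first `l` indices. -/
def lowBlock (m l : ℕ) : Finset (Fin m) := Finset.univ.filter fun a => (a : ℕ) < l

/-- The indices that are neither among the first `l` nor among the last `l` ones. -/
def midBlock (m l : ℕ) : Finset (Fin m) :=
  Finset.univ.filter fun a => l ≤ (a : ℕ) ∧ (a : ℕ) < m - l

/-- The last `l` indices. -/
def highBlock (m l : ℕ) : Finset (Fin m) := Finset.univ.filter fun a => m - l ≤ (a : ℕ)

variable {m l : ℕ}

@[simp] lemma mem_lowBlock {a : Fin m} : a ∈ lowBlock m l ↔ (a : ℕ) < l := by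
  simp [lowBlock]

@[simp] lemma mem_midBlock {a : Fin m} :
    a ∈ midBlock m l ↔ l ≤ (a : ℕ) ∧ (a : ℕ) < m - l := by
  simp [midBlock]

@[simp] lemma mem_highBlock {a : Fin m} : a ∈ highBlock m l ↔ m - l ≤ (a : ℕ) := by
  simp [highBlock]

lemma disjoint_midBlock_lowBlock : Disjoint (midBlock m l) (lowBlock m l) := by
  rw [Finset.disjoint_left]
  intro a
  simp only [mem_midBlock, mem_lowBlock]
  omega

lemma prod_blocks (h : 2 * l ≤ m) :
    epsProd (lowBlock m l) * epsProd (midBlock m l) * epsProd (highBlock m l)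
      = (-1 : ℂ) ^ (m * (m + 1) / 2) := by
  rw [← epsProd_univ, epsProd, epsProd, epsProd, epsProd, ← Finset.prod_union,
    ← Finset.prod_union]
  · congr 1
    ext a
    simp only [Finset.mem_union, mem_lowBlock, mem_midBlock, mem_highBlock, Finset.mem_univ,
      iff_true]
    omega
  · rw [Finset.disjoint_left]
    intro a
    simp only [Finset.mem_union, mem_lowBlock, mem_midBlock, mem_highBlock]
    omega
  · exact disjoint_midBlock_lowBlock.symm

lemma card_lowBlock (h : l ≤ m) : (lowBlock m l).card = l := by
  rw [← Finset.card_range l]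
  refine Finset.card_bij' (fun a _ => (a : ℕ))
    (fun b hb => ⟨b, (Finset.mem_range.mp hb).trans_le h⟩) ?_ ?_ ?_ ?_ <;> simp

lemma card_midBlock (h : 2 * l ≤ m) : (midBlock m l).card = m - 2 * l := by
  rw [show m - 2 * l = (Finset.Ico l (m - l)).card by rw [Nat.card_Ico]; omega]
  refine Finset.card_bij' (fun a _ => (a : ℕ))
    (fun b hb => ⟨b, by have := Finset.mem_Ico.mp hb; omega⟩) ?_ ?_ ?_ ?_ <;> simp

lemma prod_lowBlock_eq_epsProd_highBlock :
    ∏ a ∈ lowBlock m l, (-1 : ℂ) ^ ((a : ℕ) + 1) = epsProd (highBlock m l) := by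
  rw [epsProd_eq, psum, ← Finset.prod_pow_eq_pow_sum]
  refine Finset.prod_bij' (fun a _ => a.rev) (fun a _ => a.rev) ?_ ?_ ?_ ?_ ?_
  · intro a; simp only [mem_lowBlock, mem_highBlock, Fin.val_rev]; omega
  · intro a; have := a.isLt; simp only [mem_lowBlock, mem_highBlock, Fin.val_rev]; omega
  · simp
  · simp
  · intro a _
    have := a.isLt
    rw [Fin.val_rev]
    congr 1
    omega

lemma epsProd_eq_mul_prod (S : Finset (Fin m)) :
    epsProd S = (-1 : ℂ) ^ ((m + 1) * S.card) * ∏ a ∈ S, (-1 : ℂ) ^ ((a : ℕ) + 1) := by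
  rw [epsProd, pow_mul, ← Finset.prod_const, ← Finset.prod_mul_distrib]
  refine Finset.prod_congr rfl fun a _ => ?_
  rw [eps, pow_add]

lemma prod_transSign_midBlock (hl : 2 * l ≤ m) {L : Finset (Fin m)}
    (hL : Disjoint (midBlock m l) L) :
    ∏ a ∈ midBlock m l, transSign L a = (-1 : ℂ) ^ (m * (L ∩ lowBlock m l).card) := by
  have h : ∀ a ∈ midBlock m l, transSign L a = (-1 : ℂ) ^ (L ∩ lowBlock m l).card := by
    intro a ha
    rw [transSign]
    congr 2
    ext x
    simp only [Finset.mem_filter, Finset.mem_inter, mem_lowBlock]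
    refine and_congr_right fun hx => ?_
    have hx' : x ∉ midBlock m l := fun h => Finset.disjoint_left.mp hL h hx
    simp only [mem_midBlock] at ha hx'
    rw [Fin.lt_def]
    omega
  rw [Finset.prod_congr rfl h, Finset.prod_const, card_midBlock hl, ← pow_mul, mul_comm]
  obtain ⟨k, rfl⟩ := Nat.exists_eq_add_of_le hl
  rw [Nat.add_sub_cancel_left, add_mul, pow_add, mul_assoc 2, pow_mul _ 2]
  simp

end Blocks

section Matching

variable {m l j : ℕ}

lemma prodOpF_add_midBlock_apply (hl : 2 * l ≤ m) {I : Finset (Fin m)} (hI : I ⊆ lowBlock m l)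
    (u : VS m) (L : Finset (Fin m)) :
    prodOpF m (I.image (fun a : Fin m => (a : ℕ) + 1) ∪
        (I ∪ midBlock m l).image fun a : Fin m => 2 * m + 1 - (a : ℕ)) u L
      = if I ⊆ L ∧ Disjoint (midBlock m l) L then
          (-1 : ℂ) ^ (m * ((L \ I) ∩ lowBlock m l).card) * epsProd I * epsProd (midBlock m l)
            * u (L ∪ midBlock m l)
        else 0 := by
  have hIM : Disjoint I (midBlock m l) :=
    (disjoint_midBlock_lowBlock.mono_right hI).symm
  have hd : Disjoint (I ∪ midBlock m l) (L \ I) ↔ Disjoint (midBlock m l) L := by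
    rw [Finset.disjoint_union_left, and_iff_right Finset.disjoint_sdiff,
      Finset.disjoint_left, Finset.disjoint_left]
    refine forall₂_congr fun a ha => ?_
    have : a ∉ I := fun h => Finset.disjoint_left.mp hIM h ha
    simp [this]
  rw [prodOpF_apply]
  simp only [hd]
  split_ifs with h
  · have hu : L \ I ∪ (I ∪ midBlock m l) = L ∪ midBlock m l := by
      rw [← Finset.union_assoc, Finset.sdiff_union_of_subset h.1]
    have hsq : (∏ a ∈ I, transSign (L \ I) a) * ∏ a ∈ I, transSign (L \ I) a = 1 := by
      rw [← Finset.prod_mul_distrib]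
      exact Finset.prod_eq_one fun a _ => transSign_mul_self _ a
    have he : epsProd (I ∪ midBlock m l) = epsProd I * epsProd (midBlock m l) :=
      Finset.prod_union hIM
    rw [hu, Finset.prod_union hIM, he,
      prod_transSign_midBlock hl (h.2.mono_right Finset.sdiff_subset)]
    linear_combination ((-1 : ℂ) ^ (m * ((L \ I) ∩ lowBlock m l).card) * epsProd I *
      epsProd (midBlock m l) * u (L ∪ midBlock m l)) * hsq
  · rfl

lemma sum_proper_neg_one_pow_card (A L : Finset (Fin m)) :
    ∑ I ∈ A.powerset.filter (· ≠ A), (if I ⊆ L then (-1 : ℂ) ^ I.card else 0)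
      = (if Disjoint A L then 1 else 0) - if A ⊆ L then (-1 : ℂ) ^ A.card else 0 := by
  rw [Finset.filter_ne', Finset.sum_erase_eq_sub (Finset.mem_powerset_self A),
    ← Finset.sum_filter]
  have hf : A.powerset.filter (· ⊆ L) = (A ∩ L).powerset := by
    ext I
    simp only [Finset.mem_filter, Finset.mem_powerset, Finset.subset_inter_iff]
  have h := congrArg (Int.cast : ℤ → ℂ) (Finset.sum_powerset_neg_one_pow_card (x := A ∩ L))
  push_cast at h
  rw [hf, h]
  simp only [Finset.disjoint_iff_inter_eq_empty]

lemma Icc_one_eq_image (hl : l ≤ m) :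
    Finset.Icc 1 l = (lowBlock m l).image fun a : Fin m => (a : ℕ) + 1 := by
  ext k
  simp only [Finset.mem_Icc, Finset.mem_image, mem_lowBlock]
  constructor
  · rintro ⟨h1, h2⟩
    exact ⟨⟨k - 1, by omega⟩, by simp only; omega, by simp only; omega⟩
  · rintro ⟨a, ha, rfl⟩
    omega

lemma Icc_eq_image_midBlock (hlj : l + j = m + 1) :
    Finset.Icc (2 * m + 3 - j) (m + j)
      = (midBlock m l).image fun a : Fin m => 2 * m + 1 - (a : ℕ) := by
  ext k
  simp only [Finset.mem_Icc, Finset.mem_image, mem_midBlock]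
  constructor
  · rintro ⟨h1, h2⟩
    exact ⟨⟨2 * m + 1 - k, by omega⟩, by simp only; omega, by simp only; omega⟩
  · rintro ⟨a, ha, rfl⟩
    omega

lemma Icc_eq_image_lowBlock_union_midBlock (hl : 2 * l ≤ m) (hlj : l + j = m + 1) :
    Finset.Icc (2 * m + 3 - j) (2 * m + 1)
      = (lowBlock m l ∪ midBlock m l).image fun a : Fin m => 2 * m + 1 - (a : ℕ) := by
  ext k
  simp only [Finset.mem_Icc, Finset.mem_image, Finset.mem_union, mem_lowBlock, mem_midBlock]
  constructor
  · rintro ⟨h1, h2⟩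
    exact ⟨⟨2 * m + 1 - k, by omega⟩, by simp only; omega, by simp only; omega⟩
  · rintro ⟨a, ha, rfl⟩
    omega

/-- The sum over proper subsets in the definition of `A_{(j)}`, indexed by subsets of
`Fin m`. -/
lemma sum_proper_prodOpF (hl : 2 * l ≤ m) (hlj : l + j = m + 1) :
    ∑ I ∈ (Finset.Icc 1 l).powerset.filter (· ≠ Finset.Icc 1 l),
        (∏ k ∈ Finset.Icc 1 l \ I, (-1 : ℂ) ^ k) •
          prodOpF m (I ∪ Finset.Icc (2 * m + 3 - j) (m + j) ∪ I.image fun i => 2 * m + 2 - i)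
      = ∑ I ∈ (lowBlock m l).powerset.filter (· ≠ lowBlock m l),
          (∏ a ∈ lowBlock m l \ I, (-1 : ℂ) ^ ((a : ℕ) + 1)) •
            prodOpF m (I.image (fun a : Fin m => (a : ℕ) + 1) ∪
              (I ∪ midBlock m l).image fun a : Fin m => 2 * m + 1 - (a : ℕ)) := by
  have hinj : Function.Injective fun a : Fin m => (a : ℕ) + 1 := fun a b h =>
    Fin.ext (Nat.succ_injective h)
  rw [Icc_eq_image_midBlock hlj, Icc_one_eq_image (m := m) (by omega)]
  symm
  refine Finset.sum_bij (fun I _ => I.image fun a : Fin m => (a : ℕ) + 1) ?_ ?_ ?_ ?_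
  · intro I hI
    simp only [Finset.mem_filter, Finset.mem_powerset] at hI ⊢
    exact ⟨Finset.image_subset_image hI.1, fun h => hI.2 (Finset.image_injective hinj h)⟩
  · intro I _ K _ h
    exact Finset.image_injective hinj h
  · intro K hK
    simp only [Finset.mem_filter, Finset.mem_powerset] at hK
    obtain ⟨I, hI, rfl⟩ := Finset.subset_image_iff.mp hK.1
    have hI' : I ⊆ lowBlock m l := by exact_mod_cast hI
    refine ⟨I, ?_, rfl⟩
    simp only [Finset.mem_filter, Finset.mem_powerset]
    exact ⟨hI', fun h => hK.2 (by rw [h])⟩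
  · intro I _
    rw [← Finset.image_sdiff _ _ hinj, Finset.prod_image hinj.injOn, Finset.image_image,
      Finset.image_union, Finset.union_assoc, Finset.union_comm (I.image _) (Finset.image _ _)]
    congr 4
    refine Finset.image_congr fun a _ => ?_
    simp only [Function.comp_apply]
    omega

lemma AOpF_apply (hl : 2 * l ≤ m) (hlj : l + j = m + 1) (u : VS m) (L : Finset (Fin m)) :
    AOpF m j u L
      = (if lowBlock m l ⊆ L ∧ Disjoint (midBlock m l) L then
          epsProd (highBlock m l) / 2 * u (L ∪ midBlock m l) else 0)
        + if Disjoint (lowBlock m l) L ∧ Disjoint (midBlock m l) L then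
          epsProd (lowBlock m l) / 2 * u (L ∪ midBlock m l) else 0 := by
  have hlow : epsProd (lowBlock m l) = (-1 : ℂ) ^ ((m + 1) * l) * epsProd (highBlock m l) := by
    rw [epsProd_eq_mul_prod, card_lowBlock (by omega), prod_lowBlock_eq_epsProd_highBlock]
  have hterm : ∀ I ∈ (lowBlock m l).powerset.filter (· ≠ lowBlock m l),
      (∏ a ∈ lowBlock m l \ I, (-1 : ℂ) ^ ((a : ℕ) + 1)) *
        prodOpF m (I.image (fun a : Fin m => (a : ℕ) + 1) ∪
          (I ∪ midBlock m l).image fun a : Fin m => 2 * m + 1 - (a : ℕ)) u L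
      = (if Disjoint (midBlock m l) L then
          epsProd (highBlock m l) * (-1 : ℂ) ^ (m * (L ∩ lowBlock m l).card) *
            epsProd (midBlock m l) * u (L ∪ midBlock m l) else 0) *
          if I ⊆ L then (-1 : ℂ) ^ I.card else 0 := by
    intro I hI
    have hI' : I ⊆ lowBlock m l := Finset.mem_powerset.mp (Finset.mem_filter.mp hI).1
    rw [prodOpF_add_midBlock_apply hl hI']
    by_cases h1 : I ⊆ L
    · by_cases h2 : Disjoint (midBlock m l) L
      · rw [if_pos ⟨h1, h2⟩, if_pos h2, if_pos h1, epsProd_eq_mul_prod I,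
          ← prod_lowBlock_eq_epsProd_highBlock, ← Finset.prod_sdiff hI']
        have hc : ((L \ I) ∩ lowBlock m l).card + I.card = (L ∩ lowBlock m l).card := by
          rw [← Finset.card_union_of_disjoint]
          · congr 1
            ext x
            have := @h1 x
            have := @hI' x
            simp only [Finset.mem_union, Finset.mem_inter, Finset.mem_sdiff]
            tauto
          · exact Finset.sdiff_disjoint.mono_left Finset.inter_subset_left
        rw [← hc, mul_add, pow_add, add_mul, pow_add, one_mul]
        ring
      · simp [h2]
    · simp [h1]
  have hsum := Finset.sum_congr rfl hterm
  rw [← Finset.mul_sum, sum_proper_neg_one_pow_card, card_lowBlock (by omega)] at hsum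
  rw [AOpF, show m + 1 - j = l by omega, sum_proper_prodOpF hl hlj,
    Icc_eq_image_lowBlock_union_midBlock hl hlj, Icc_one_eq_image (m := m) (by omega)]
  simp only [LinearMap.smul_apply, LinearMap.add_apply, LinearMap.sum_apply, Pi.smul_apply,
    Pi.add_apply, Finset.sum_apply, smul_eq_mul]
  rw [hsum, prodOpF_add_midBlock_apply hl subset_rfl, ← prod_blocks hl,
    Finset.sdiff_inter_self]
  by_cases h2 : Disjoint (midBlock m l) L
  · simp only [h2, and_true, if_true]
    have hM := epsProd_mul_self (midBlock m l)
    have hLo := epsProd_mul_self (lowBlock m l)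
    have hHi := epsProd_mul_self (highBlock m l)
    have h1 : (if lowBlock m l ⊆ L then (-1 : ℂ) ^ (m * (L ∩ lowBlock m l).card) * (-1) ^ l *
        epsProd (highBlock m l) else 0)
        = if lowBlock m l ⊆ L then epsProd (lowBlock m l) else 0 := by
      split_ifs with h
      · rw [Finset.inter_eq_right.mpr h, card_lowBlock (by omega), hlow, add_mul, pow_add,
          one_mul]
      · rfl
    have h3 : (if Disjoint (lowBlock m l) L then (-1 : ℂ) ^ (m * (L ∩ lowBlock m l).card)
        else 0) = if Disjoint (lowBlock m l) L then 1 else 0 := by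
      split_ifs with h
      · rw [Finset.disjoint_iff_inter_eq_empty.mp h.symm]
        simp
      · rfl
    generalize epsProd (midBlock m l) = M at *
    generalize epsProd (lowBlock m l) = A at *
    generalize epsProd (highBlock m l) = B at *
    generalize u (L ∪ midBlock m l) = w at *
    generalize (-1 : ℂ) ^ (m * (L ∩ lowBlock m l).card) = t at *
    by_cases hs : lowBlock m l ⊆ L <;> by_cases hd : Disjoint (lowBlock m l) L <;>
      simp only [hs, hd, if_true, if_false, Finset.card_empty, mul_zero, pow_zero] at h1 h3 ⊢
    · linear_combination A * M ^ 2 * B * w / 2 * (B * h3 - h1) +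
        w * B / 2 * (A ^ 2 * hM + hLo) + w * A / 2 * (B ^ 2 * hM + hHi)
    · linear_combination -(A * M ^ 2 * B * w / 2) * h1 + w * B / 2 * (A ^ 2 * hM + hLo)
    · linear_combination A * M ^ 2 * B * w / 2 * (B * h3) + w * A / 2 * (B ^ 2 * hM + hHi)
    · ring
  · simp [h2]

end Matching

section Duality

variable {m l : ℕ}

lemma IofP_image (X : Finset (Fin m)) : IofP m (X.image fun a : Fin m => m - (a : ℕ)) = X := by
  ext a
  simp only [IofP, Finset.mem_filter, Finset.mem_univ, true_and, Finset.mem_image]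
  constructor
  · rintro ⟨b, hb, h⟩
    have : b = a := by
      have := a.isLt
      have := b.isLt
      ext
      omega
    exact this ▸ hb
  · exact fun h => ⟨a, h, rfl⟩

lemma IofP_Icc_one : IofP m (Finset.Icc 1 l) = highBlock m l := by
  ext a
  have := a.isLt
  simp only [IofP, Finset.mem_filter, Finset.mem_univ, true_and, Finset.mem_Icc, mem_highBlock]
  omega

lemma IofP_Icc_top : IofP m (Finset.Icc (m + 1 - l) m) = lowBlock m l := by
  ext a
  have := a.isLt
  simp only [IofP, Finset.mem_filter, Finset.mem_univ, true_and, Finset.mem_Icc, mem_lowBlock]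
  omega

lemma IofP_sdiff (P Q : Finset ℕ) : IofP m (P \ Q) = IofP m P \ IofP m Q := by
  ext a
  simp [IofP]

lemma IofP_union (P Q : Finset ℕ) : IofP m (P ∪ Q) = IofP m P ∪ IofP m Q := by
  ext a
  simp [IofP]

lemma image_IofP {J : Finset ℕ} (hJ : J ⊆ Finset.Icc 1 m) :
    ((IofP m J).image fun a : Fin m => m - (a : ℕ)) = J := by
  ext k
  simp only [IofP, Finset.mem_filter, Finset.mem_univ, true_and, Finset.mem_image]
  constructor
  · rintro ⟨a, ha, rfl⟩
    exact ha
  · intro hk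
    have := Finset.mem_Icc.mp (hJ hk)
    have hk' : m - (m - k) = k := by omega
    exact ⟨⟨m - k, by omega⟩, by simpa [hk'] using hk, by simpa using hk'⟩

lemma sJ_eq_psum {J : Finset ℕ} (hJ : J ⊆ Finset.Icc 1 m) : sJ J = psum m (IofP m J) := by
  conv_lhs => rw [← image_IofP hJ]
  rw [sJ, psum, Finset.sum_image]
  intro a _ b _ h
  have := a.isLt
  have := b.isLt
  ext
  simp only at h
  omega

lemma wMu_eq (hl : 2 * l ≤ m) {J : Finset ℕ} (hJ : J ⊆ Finset.Icc 1 l) :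
    wMu m l J = wB (lowBlock m l ∪ IofP m J) := by
  rw [wMu, if_pos, wP, IofP_union, IofP_Icc_top]
  rw [Finset.disjoint_left]
  intro k hk hkJ
  have := Finset.mem_Icc.mp (hJ hkJ)
  have := Finset.mem_Icc.mp hk
  omega

/-- The image of `D_{(j)}` in `End(V_Spin)`, indexed by subsets of the last `l` indices. -/
lemma sum_delta_eq (hl : 2 * l ≤ m) (u : VS m) :
    ∑ I ∈ (Finset.Icc 1 l).powerset,
        ((-1 : ℂ) ^ (sJ I)) •
          ((1 / 2 : ℂ) •
            ((deltaF m (wP m (Finset.Icc 1 l \ I)) u) • wMu m l I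
              + (deltaF m (wMu m l I) u) • wP m (Finset.Icc 1 l \ I)))
      = ∑ X ∈ (highBlock m l).powerset,
          ((-1 : ℂ) ^ psum m X) •
            ((1 / 2 : ℂ) •
              ((deltaF m (wB (highBlock m l \ X)) u) • wB (lowBlock m l ∪ X)
                + (deltaF m (wB (lowBlock m l ∪ X)) u) • wB (highBlock m l \ X))) := by
  have hsub : Finset.Icc 1 l ⊆ Finset.Icc 1 m := Finset.Icc_subset_Icc_right (by omega)
  refine Finset.sum_bij' (fun J _ => IofP m J)
    (fun X _ => X.image fun a : Fin m => m - (a : ℕ)) ?_ ?_ ?_ ?_ ?_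
  · intro J hJ
    have hJ := Finset.mem_powerset.mp hJ
    rw [Finset.mem_powerset, ← IofP_Icc_one]
    intro a
    simp only [IofP, Finset.mem_filter, Finset.mem_univ, true_and]
    exact fun h => hJ h
  · intro X hX
    rw [Finset.mem_powerset, ← image_IofP hsub, IofP_Icc_one]
    exact Finset.image_subset_image (Finset.mem_powerset.mp hX)
  · exact fun J hJ => image_IofP ((Finset.mem_powerset.mp hJ).trans hsub)
  · exact fun X _ => IofP_image X
  · intro J hJ
    have hJ := Finset.mem_powerset.mp hJ
    rw [sJ_eq_psum (hJ.trans hsub), wMu_eq hl hJ, wP, IofP_sdiff, IofP_Icc_one]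

lemma epsProd_mul_epsProd_sdiff {A X : Finset (Fin m)} (h : X ⊆ A) :
    epsProd X * epsProd (A \ X) = epsProd A := by
  rw [mul_comm, epsProd, epsProd, epsProd, Finset.prod_sdiff h]

lemma disjoint_lowBlock_highBlock (hl : 2 * l ≤ m) :
    Disjoint (lowBlock m l) (highBlock m l) := by
  rw [Finset.disjoint_left]
  intro a
  simp only [mem_lowBlock, mem_highBlock]
  omega

lemma sum_highBlock_low_union (hl : 2 * l ≤ m) (u : VS m) (L : Finset (Fin m)) :
    ∑ X ∈ (highBlock m l).powerset, epsProd X *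
        (epsProd (highBlock m l \ X) * u (highBlock m l \ X)ᶜ * wB (lowBlock m l ∪ X) L)
      = if lowBlock m l ⊆ L ∧ Disjoint (midBlock m l) L then
          epsProd (highBlock m l) * u (L ∪ midBlock m l) else 0 := by
  split_ifs with h
  · have hL : L = lowBlock m l ∪ (L ∩ highBlock m l) := by
      ext a
      have h1 := @h.1 a
      have h2 : a ∈ midBlock m l → a ∉ L := fun h' => Finset.disjoint_left.mp h.2 h'
      simp only [Finset.mem_union, Finset.mem_inter, mem_lowBlock, mem_highBlock,
        mem_midBlock] at h1 h2 ⊢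
      by_cases ha : a ∈ L <;> simp only [ha, not_true_eq_false, not_false_eq_true, imp_false,
        imp_true_iff, true_and, false_and, or_false, true_iff, false_iff] at h1 h2 ⊢ <;> omega
    have hu : (highBlock m l \ (L ∩ highBlock m l))ᶜ = L ∪ midBlock m l := by
      ext a
      have h1 := @h.1 a
      simp only [Finset.mem_union, Finset.mem_inter, Finset.mem_compl, Finset.mem_sdiff,
        mem_lowBlock, mem_highBlock, mem_midBlock] at h1 ⊢
      by_cases ha : a ∈ L
      · simp [ha]
      · simp only [ha, imp_false, false_and, not_false_eq_true, and_true, false_or] at h1 ⊢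
        omega
    rw [Finset.sum_eq_single (L ∩ highBlock m l)]
    · rw [hu, wB, if_pos hL, ← epsProd_mul_epsProd_sdiff (A := highBlock m l)
        (Finset.inter_subset_right (s₁ := L))]
      ring
    · intro X hX hne
      rw [wB, if_neg, mul_zero, mul_zero]
      rintro rfl
      apply hne
      rw [Finset.union_inter_distrib_right,
        Finset.disjoint_iff_inter_eq_empty.mp (disjoint_lowBlock_highBlock hl),
        Finset.inter_eq_left.mpr (Finset.mem_powerset.mp hX), Finset.empty_union]
    · intro hX
      exact absurd (Finset.mem_powerset.mpr Finset.inter_subset_right) hX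
  · refine Finset.sum_eq_zero fun X hX => ?_
    rw [wB, if_neg, mul_zero, mul_zero]
    rintro rfl
    refine h ⟨Finset.subset_union_left, ?_⟩
    rw [Finset.disjoint_left]
    intro a ha haL
    have hX' : a ∈ X → a ∈ highBlock m l := fun h' => Finset.mem_powerset.mp hX h'
    simp only [Finset.mem_union, mem_lowBlock, mem_highBlock, mem_midBlock] at *
    rcases haL with h' | h'
    · omega
    · have := hX' h'
      omega

lemma sum_highBlock_sdiff (hl : 2 * l ≤ m) (u : VS m) (L : Finset (Fin m)) :
    ∑ X ∈ (highBlock m l).powerset, epsProd X *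
        (epsProd (lowBlock m l ∪ X) * u (lowBlock m l ∪ X)ᶜ * wB (highBlock m l \ X) L)
      = if Disjoint (lowBlock m l) L ∧ Disjoint (midBlock m l) L then
          epsProd (lowBlock m l) * u (L ∪ midBlock m l) else 0 := by
  split_ifs with h
  · have hLs : L ⊆ highBlock m l := by
      intro a ha
      have h1 : a ∉ lowBlock m l := fun h' => Finset.disjoint_left.mp h.1 h' ha
      have h2 : a ∉ midBlock m l := fun h' => Finset.disjoint_left.mp h.2 h' ha
      simp only [mem_lowBlock, mem_highBlock, mem_midBlock] at h1 h2 ⊢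
      omega
    have hu : (lowBlock m l ∪ highBlock m l \ L)ᶜ = L ∪ midBlock m l := by
      ext a
      have h1 := @hLs a
      simp only [Finset.mem_union, Finset.mem_compl, Finset.mem_sdiff,
        mem_lowBlock, mem_highBlock, mem_midBlock] at h1 ⊢
      by_cases ha : a ∈ L
      · simp only [ha, forall_const, not_true_eq_false, and_false, or_false, true_or,
          iff_true] at h1 ⊢
        omega
      · simp only [ha, not_false_eq_true, and_true, false_or]
        omega
    rw [Finset.sum_eq_single (highBlock m l \ L)]
    · have he : epsProd (lowBlock m l ∪ highBlock m l \ L)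
          = epsProd (lowBlock m l) * epsProd (highBlock m l \ L) :=
        Finset.prod_union ((disjoint_lowBlock_highBlock hl).mono_right Finset.sdiff_subset)
      rw [hu, wB, if_pos (Finset.sdiff_sdiff_eq_self hLs).symm, he]
      linear_combination epsProd (lowBlock m l) * u (L ∪ midBlock m l) *
        epsProd_mul_self (highBlock m l \ L)
    · intro X hX hne
      rw [wB, if_neg, mul_zero, mul_zero]
      rintro rfl
      exact hne (Finset.sdiff_sdiff_eq_self (Finset.mem_powerset.mp hX)).symm
    · intro hX
      exact absurd (Finset.mem_powerset.mpr Finset.sdiff_subset) hX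
  · refine Finset.sum_eq_zero fun X hX => ?_
    rw [wB, if_neg, mul_zero, mul_zero]
    rintro rfl
    refine h ⟨(disjoint_lowBlock_highBlock hl).mono_right Finset.sdiff_subset, ?_⟩
    rw [Finset.disjoint_left]
    intro a ha haL
    have := (Finset.mem_sdiff.mp haL).1
    simp only [mem_highBlock, mem_midBlock] at *
    omega

end Duality

/-- Let `(m+1)/2 < j ≤ m`. Then for every `u ∈ V_Spin`:
`A_{(j)} · u = Σ_{I ⊆ {1,…,m+1−j}} (−1)^(s(I)) (1/2) [ δ(w_{ρ_{m+1−j}^I})(u) · w_{μ_{m+1−j}^I}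
+ δ(w_{μ_{m+1−j}^I})(u) · w_{ρ_{m+1−j}^I} ]`; that is, the Clifford action of `A_{(j)}`
equals the image in `End(V_Spin)` of the element
`D_{(j)} = Σ_I (−1)^(s(I)) w_{ρ_{m+1−j}^I} w_{μ_{m+1−j}^I} ∈ Sym²(V_Spin)` under the map
`w w' ↦ (1/2)(δ(w) ⊗ w' + δ(w') ⊗ w)`. -/
theorem A_action_equals_D (m j : ℕ) (hm : 2 ≤ m) (hj : m + 1 < 2 * j) (hjm : j ≤ m)
    (u : VS m) :
    AOpF m j u
      = ∑ I ∈ (Finset.Icc 1 (m + 1 - j)).powerset,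
          ((-1 : ℂ) ^ (sJ I)) •
            ((1 / 2 : ℂ) •
              ((deltaF m (wP m (Finset.Icc 1 (m + 1 - j) \ I)) u) • wMu m (m + 1 - j) I
                + (deltaF m (wMu m (m + 1 - j) I) u) •
                    wP m (Finset.Icc 1 (m + 1 - j) \ I))) := by
  obtain ⟨l, hlj⟩ : ∃ l, l + j = m + 1 := ⟨m + 1 - j, by omega⟩
  have hl : 2 * l ≤ m := by omega
  rw [show m + 1 - j = l by omega, sum_delta_eq hl]
  funext L
  rw [AOpF_apply hl hlj]
  simp only [deltaF_wB, ← epsProd_eq, Finset.sum_apply, Pi.smul_apply, Pi.add_apply, smul_eq_mul]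
  have h1 := sum_highBlock_low_union hl u L
  have h2 := sum_highBlock_sdiff hl u L
  have h3 := congrArg₂ (fun x y : ℂ => 1 / 2 * (x + y)) h1 h2
  simp only [← Finset.sum_add_distrib, Finset.mul_sum] at h3
  refine Eq.trans ?_ (h3.symm.trans (Finset.sum_congr rfl fun X _ => by ring))
  split_ifs <;> ring

end
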